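/- For u ≥ 0 the function Ω(u) = 4 e^{u/2} ∑_{n=1}^∞ π n² e^{2u} (2π n² e^{2u} − 3) exp(−π n² e^{2u}) is non-increasing; equivalently its derivative Ω'(u) = −2 e^{u/2} ∑_{n=1}^∞ π n² e^{2u} (8(π n² e^{2u})² − 30 π n² e^{2u} + 15) exp(−π n² e^{2u}) satisfies Ω'(u) ≤ 0 for all u ≥ 0. -/

import Mathlib

open Real

noncomputable def Omega (u : ℝ) : ℝ :=
  4 * Real.exp (u / 2) *
    ∑' n : ℕ, π * ((n : ℝ) + 1) ^ 2 * Real.exp (2 * u) *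
      (2 * π * ((n : ℝ) + 1) ^ 2 * Real.exp (2 * u) - 3) *
      Real.exp (-π * ((n : ℝ) + 1) ^ 2 * Real.exp (2 * u))

noncomputable def Omega' (u : ℝ) : ℝ :=
  -2 * Real.exp (u / 2) *
    ∑' n : ℕ, π * ((n : ℝ) + 1) ^ 2 * Real.exp (2 * u) *
      (8 * (π * ((n : ℝ) + 1) ^ 2 * Real.exp (2 * u)) ^ 2
        - 30 * (π * ((n : ℝ) + 1) ^ 2 * Real.exp (2 * u)) + 15) *
      Real.exp (-π * ((n : ℝ) + 1) ^ 2 * Real.exp (2 * u))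


open Polynomial in
lemma poly_bound (P : ℝ[X]) : ∃ C : ℝ, 0 ≤ C ∧ ∀ x : ℝ, 0 ≤ x → |P.eval x| ≤ C * Real.exp (x / 2) := by
  induction P using Polynomial.induction_on' with
  | add p q hp hq =>
    obtain ⟨C, hC, h1⟩ := hp
    obtain ⟨D, hD, h2⟩ := hq
    refine ⟨C + D, by positivity, fun x hx => ?_⟩
    rw [Polynomial.eval_add, add_mul]
    exact (abs_add_le _ _).trans (add_le_add (h1 x hx) (h2 x hx))
  | monomial k a =>
    refine ⟨|a| * (2 ^ k * (k.factorial : ℝ)), by positivity, fun x hx => ?_⟩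
    have h := Real.pow_div_factorial_le_exp (x / 2) (by positivity) k
    rw [Polynomial.eval_monomial, abs_mul, abs_of_nonneg (pow_nonneg hx k), mul_assoc]
    refine mul_le_mul_of_nonneg_left ?_ (abs_nonneg a)
    rw [div_le_iff₀ (by positivity), div_pow, div_le_iff₀ (by positivity)] at h
    linarith

/-- the argument `x_n(u)` -/
noncomputable def xx (n : ℕ) (u : ℝ) : ℝ := π * ((n : ℝ) + 1) ^ 2 * Real.exp (2 * u)

lemma xx_nonneg (n : ℕ) (u : ℝ) : 0 ≤ xx n u := by unfold xx; positivity

noncomputable def tm (P : Polynomial ℝ) (n : ℕ) (u : ℝ) : ℝ := P.eval (xx n u) * Real.exp (-xx n u)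

noncomputable def TT (P : Polynomial ℝ) (u : ℝ) : ℝ := ∑' n, tm P n u

lemma tm_bound (P : Polynomial ℝ) (a : ℝ) :
    ∃ b : ℕ → ℝ, Summable b ∧ ∀ n u, a < u → ‖tm P n u‖ ≤ b n := by
  obtain ⟨C, hC, h⟩ := poly_bound P
  set c := π * Real.exp (2 * a) / 2 with hc
  have hc0 : 0 < c := by positivity
  refine ⟨fun n => C * Real.exp (n * (-c)), ?_, fun n u hu => ?_⟩
  · exact (Real.summable_exp_nat_mul_iff.mpr (by linarith)).mul_left C
  · have h1 := h (xx n u) (xx_nonneg n u)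
    rw [tm, Real.norm_eq_abs, abs_mul, Real.abs_exp]
    have h2 : (n : ℝ) * c ≤ xx n u / 2 := by
      have e1 : Real.exp (2 * a) ≤ Real.exp (2 * u) := Real.exp_le_exp.mpr (by linarith)
      have e2 : (n : ℝ) ≤ ((n : ℝ) + 1) ^ 2 := by nlinarith [(Nat.cast_nonneg n : (0:ℝ) ≤ n)]
      have : (n : ℝ) * (π * Real.exp (2 * a)) ≤ π * ((n : ℝ) + 1) ^ 2 * Real.exp (2 * u) := by
        calc (n : ℝ) * (π * Real.exp (2 * a)) = π * n * Real.exp (2 * a) := by ring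
          _ ≤ _ := by gcongr
      rw [xx, hc]; linarith
    calc |P.eval (xx n u)| * Real.exp (-xx n u)
        ≤ (C * Real.exp (xx n u / 2)) * Real.exp (-xx n u) := by gcongr
      _ = C * Real.exp (-(xx n u / 2)) := by
        rw [mul_assoc, ← Real.exp_add]; congr 2; ring
      _ ≤ C * Real.exp (n * (-c)) := by
        gcongr; linarith

lemma tm_summable (P : Polynomial ℝ) (u : ℝ) : Summable (fun n => tm P n u) := by
  obtain ⟨b, hb, h⟩ := tm_bound P (u - 1)
  exact Summable.of_norm_bounded hb (fun n => h n u (by linarith))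

open Polynomial in
noncomputable def D0 (P : ℝ[X]) : ℝ[X] := C 2 * X * (derivative P - P)

lemma xx_deriv (n : ℕ) (u : ℝ) : HasDerivAt (xx n) (2 * xx n u) u := by
  unfold xx
  have h : HasDerivAt (fun u : ℝ => 2 * u) 2 u := by simpa using (hasDerivAt_id u).const_mul 2
  exact ((h.exp).const_mul (π * ((n : ℝ) + 1) ^ 2)).congr_deriv (by ring)

lemma tm_deriv (P : Polynomial ℝ) (n : ℕ) (u : ℝ) : HasDerivAt (tm P n) (tm (D0 P) n u) u := by
  have h := xx_deriv n u
  have h1 := (P.hasDerivAt (xx n u)).comp u h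
  have h2 := h1.mul (h.neg.exp)
  refine HasDerivAt.congr_deriv (f := tm P n) h2 ?_
  simp [tm, D0]
  ring

lemma TT_deriv (P : Polynomial ℝ) (u : ℝ) : HasDerivAt (TT P) (TT (D0 P) u) u := by
  obtain ⟨b, hb, h⟩ := tm_bound (D0 P) (u - 1)
  exact hasDerivAt_tsum_of_isPreconnected (t := Set.Ioi (u - 1)) (y₀ := u) (y := u) hb isOpen_Ioi
    isPreconnected_Ioi (fun n y _ => tm_deriv P n y) (fun n y hy => h n y hy)
    (by simp) (tm_summable P u) (by simp)

/-- `e^{u/2} T_P(u)` -/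
noncomputable def EE (P : Polynomial ℝ) (u : ℝ) : ℝ := Real.exp (u / 2) * TT P u

lemma TT_add (P Q : Polynomial ℝ) (u : ℝ) : TT (P + Q) u = TT P u + TT Q u := by
  rw [TT, TT, TT, ← (tm_summable P u).tsum_add (tm_summable Q u)]
  congr 1; ext n; simp [tm]; ring

lemma TT_C (c : ℝ) (Q : Polynomial ℝ) (u : ℝ) : TT (Polynomial.C c * Q) u = c * TT Q u := by
  rw [TT, TT, ← tsum_mul_left]
  congr 1; ext n; simp [tm]; ring

noncomputable def DD (P : Polynomial ℝ) : Polynomial ℝ := Polynomial.C (1/2) * P + D0 P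

lemma exp_half_deriv (u : ℝ) : HasDerivAt (fun u : ℝ => Real.exp (u / 2)) (Real.exp (u / 2) / 2) u := by
  have h : HasDerivAt (fun u : ℝ => u / 2) (1 / 2) u := (hasDerivAt_id u).div_const 2
  convert h.exp using 1
  ring

lemma EE_deriv (P : Polynomial ℝ) (u : ℝ) : HasDerivAt (EE P) (EE (DD P) u) u := by
  refine HasDerivAt.congr_deriv (f := EE P) ((exp_half_deriv u).mul (TT_deriv P u)) ?_
  rw [EE, DD, TT_add, TT_C]; ring

noncomputable def PO : Polynomial ℝ :=
  Polynomial.C 4 * (Polynomial.C 2 * Polynomial.X ^ 2 - Polynomial.C 3 * Polynomial.X)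

noncomputable def PG : Polynomial ℝ :=
  Polynomial.X * (Polynomial.C 8 * Polynomial.X ^ 2 - Polynomial.C 30 * Polynomial.X + Polynomial.C 15)

lemma Omega_eq : Omega = EE PO := by
  ext u
  rw [Omega, EE, PO, TT_C, TT, ← mul_assoc, mul_comm (4:ℝ)]
  congr 2; ext n
  simp only [tm, xx, Polynomial.eval_sub, Polynomial.eval_mul, Polynomial.eval_C, Polynomial.eval_pow, Polynomial.eval_X]
  rw [neg_mul, neg_mul]; ring

lemma Omega'_eq (u : ℝ) : Omega' u = -2 * Real.exp (u / 2) * TT PG u := by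
  rw [Omega', TT]
  congr 2; ext n
  simp only [tm, xx, PG, Polynomial.eval_sub, Polynomial.eval_add, Polynomial.eval_mul, Polynomial.eval_C, Polynomial.eval_pow, Polynomial.eval_X]
  rw [neg_mul, neg_mul]

lemma DD_PO : DD PO = Polynomial.C (-2) * PG := by
  apply Polynomial.funext
  intro x
  simp [DD, D0, PO, PG]
  ring

lemma Omega_deriv (u : ℝ) : HasDerivAt Omega (Omega' u) u := by
  rw [Omega_eq]
  convert EE_deriv PO u using 1
  rw [Omega'_eq, DD_PO, EE, TT_C]; ring

lemma odd_of_even {f f' : ℝ → ℝ} (h : ∀ u, HasDerivAt f (f' u) u) (he : ∀ u, f (-u) = f u) (u : ℝ) :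
    f' (-u) = - f' u := by
  have h1 : HasDerivAt (fun v => f (-v)) (f' (-u) * (-1)) u := (h (-u)).comp u (hasDerivAt_neg u)
  have h2 : (fun v => f (-v)) = f := funext he
  rw [h2] at h1
  have := h1.unique (h u)
  linarith

lemma even_of_odd {f f' : ℝ → ℝ} (h : ∀ u, HasDerivAt f (f' u) u) (he : ∀ u, f (-u) = - f u) (u : ℝ) :
    f' (-u) = f' u := by
  have h1 : HasDerivAt (fun v => f (-v)) (f' (-u) * (-1)) u := (h (-u)).comp u (hasDerivAt_neg u)
  have h2 : (fun v => f (-v)) = fun v => - f v := funext he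
  rw [h2] at h1
  have := h1.unique (h u).neg
  linarith

noncomputable def phi (u : ℝ) : ℝ := Real.exp (u / 2) + 2 * EE 1 u

lemma phi_eq (u : ℝ) : phi u = Real.exp (u / 2) * ∑' n : ℤ, Real.exp (-π * Real.exp (2 * u) * (n : ℝ) ^ 2) := by
  have hs := tm_summable 1 u
  have key : HasSum (fun n : ℕ => Real.exp (-π * Real.exp (2 * u) * ((n : ℝ) + 1) ^ 2)) (TT 1 u) := by
    have h0 : HasSum (fun n => tm 1 n u) (TT 1 u) := hs.hasSum
    convert h0 using 1
    ext n
    simp only [tm, xx, Polynomial.eval_one, one_mul]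
    congr 1; ring
  have h1 : HasSum (fun n : ℤ => Real.exp (-π * Real.exp (2 * u) * (n : ℝ) ^ 2))
      (TT 1 u + Real.exp (-π * Real.exp (2 * u) * ((0:ℤ) : ℝ) ^ 2) + TT 1 u) := by
    apply HasSum.of_add_one_of_neg_add_one
    · convert key using 3; push_cast; ring
    · convert key using 3; push_cast; ring
  rw [h1.tsum_eq, phi, EE]
  simp
  ring

lemma phi_even (u : ℝ) : phi (-u) = phi u := by
  rw [phi_eq, phi_eq, Real.tsum_exp_neg_mul_int_sq (Real.exp_pos (2 * u)), ← mul_assoc]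
  congr 1
  · rw [← Real.exp_mul, one_div, ← Real.exp_neg, ← Real.exp_add]; congr 1; ring
  · congr 1; ext n; congr 2
    rw [mul_neg, Real.exp_neg, div_eq_mul_inv]

lemma phi_deriv (u : ℝ) : HasDerivAt phi (Real.exp (u / 2) / 2 + 2 * EE (DD 1) u) u :=
  (exp_half_deriv u).add ((EE_deriv 1 u).const_mul 2)

lemma phi_deriv2 (u : ℝ) : HasDerivAt (fun u => Real.exp (u / 2) / 2 + 2 * EE (DD 1) u)
    (Real.exp (u / 2) / 2 / 2 + 2 * EE (DD (DD 1)) u) u :=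
  ((exp_half_deriv u).div_const 2).add ((EE_deriv (DD 1) u).const_mul 2)

lemma Omega_phi (u : ℝ) : Omega u = (Real.exp (u / 2) / 2 / 2 + 2 * EE (DD (DD 1)) u) - phi u / 4 := by
  have : PO = Polynomial.C 2 * DD (DD 1) + Polynomial.C (-1/2) * 1 := by
    apply Polynomial.funext
    intro x
    simp [DD, D0, PO]
    ring
  rw [Omega_eq, this, phi, EE, TT_add, TT_C, TT_C, EE, EE]; ring

lemma Omega_even (u : ℝ) : Omega (-u) = Omega u := by
  have h1 := odd_of_even phi_deriv phi_even
  have h2 := even_of_odd phi_deriv2 h1 u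
  rw [Omega_phi, Omega_phi, h2, phi_even]

lemma TT_zero : TT PG 0 = 0 := by
  have h := odd_of_even Omega_deriv Omega_even 0
  rw [neg_zero, Omega'_eq] at h
  simp at h
  linarith

/-- polynomial `x (8x²-30x+15)` -/
lemma PG_eval (x : ℝ) : PG.eval x = x * (8 * x ^ 2 - 30 * x + 15) := by simp [PG]

lemma tail_bound (k : ℕ) (y : ℝ) (hy : 1 ≤ y) :
    -(y - 1) * (Real.exp (-π) * (12600 / π ^ 4 * (1 / ((k : ℝ) + 1) ^ 4))) ≤
    PG.eval (π * ((k : ℝ) + 2) ^ 2 * y) * Real.exp (-(π * ((k : ℝ) + 2) ^ 2 * y))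
     - PG.eval (π * ((k : ℝ) + 2) ^ 2) * Real.exp (-(π * ((k : ℝ) + 2) ^ 2)) := by
  have hk : (0:ℝ) ≤ k := Nat.cast_nonneg k
  have hpi := Real.pi_gt_three
  set N := π * ((k : ℝ) + 2) ^ 2 with hN
  have hN12 : 12 ≤ N := by nlinarith [mul_nonneg hk hk]
  have hNy : N ≤ N * y := by nlinarith
  have hp : PG.eval N ≤ PG.eval (N * y) := by
    rw [PG_eval, PG_eval]
    have : 0 ≤ 8 * N ^ 2 - 30 * N + 15 := by nlinarith
    have h2 : 8 * N ^ 2 - 30 * N + 15 ≤ 8 * (N * y) ^ 2 - 30 * (N * y) + 15 := by nlinarith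
    exact mul_le_mul hNy h2 this (by linarith)
  have hp0 : 0 ≤ PG.eval N := by
    rw [PG_eval]
    have : 0 ≤ 8 * N ^ 2 - 30 * N + 15 := by nlinarith
    exact mul_nonneg (by linarith) this
  have he : Real.exp (-N) * (1 - N * (y - 1)) ≤ Real.exp (-(N * y)) := by
    have : Real.exp (-(N * y)) = Real.exp (-N) * Real.exp (-(N * (y - 1))) := by
      rw [← Real.exp_add]; congr 1; ring
    rw [this]
    have := Real.add_one_le_exp (-(N * (y - 1)))
    gcongr; linarith
  have h3 : PG.eval N * (Real.exp (-N) * (1 - N * (y - 1))) ≤ PG.eval (N * y) * Real.exp (-(N * y)) :=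
    (mul_le_mul_of_nonneg_left he hp0).trans (mul_le_mul_of_nonneg_right hp (Real.exp_pos _).le)
  -- the size of N p(N) e^{-N}
  set M := N - π with hM
  have hMk : 3 * π * ((k : ℝ) + 1) ≤ M := by rw [hM, hN]; nlinarith [mul_nonneg hk hk, mul_nonneg (mul_nonneg hk hk) Real.pi_pos.le, mul_nonneg hk Real.pi_pos.le]
  have hM0 : 0 < M := by nlinarith
  have hNM : N ≤ 4 / 3 * M := by rw [hM, hN]; nlinarith [mul_nonneg hk hk, mul_nonneg (mul_nonneg hk hk) Real.pi_pos.le, mul_nonneg hk Real.pi_pos.le]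
  have h4 : N * PG.eval N ≤ 8 * (4 / 3 * M) ^ 4 := by
    have : N * PG.eval N ≤ 8 * N ^ 4 := by
      rw [PG_eval]; nlinarith [mul_nonneg (sq_nonneg N) (by linarith : 0 ≤ 30 * N - 15)]
    have : N ^ 4 ≤ (4 / 3 * M) ^ 4 := by gcongr
    linarith
  have h5 : M ^ 4 * Real.exp (-M) ≤ 40320 / M ^ 4 := by
    have h := Real.pow_div_factorial_le_exp M hM0.le 8
    have h8 : ((Nat.factorial 8 : ℕ) : ℝ) = 40320 := by norm_num [Nat.factorial]
    rw [h8, div_le_iff₀ (by norm_num)] at h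
    rw [Real.exp_neg, le_div_iff₀ (by positivity), ← div_eq_mul_inv, div_mul_eq_mul_div, div_le_iff₀ (Real.exp_pos _)]
    calc M ^ 4 * M ^ 4 = M ^ 8 := by ring
      _ ≤ _ := by linarith
  have h6 : 40320 / M ^ 4 ≤ 40320 / (3 * π * ((k : ℝ) + 1)) ^ 4 := by gcongr
  have h7 : N * PG.eval N * Real.exp (-N) ≤ Real.exp (-π) * (12600 / π ^ 4 * (1 / ((k : ℝ) + 1) ^ 4)) := by
    have : Real.exp (-N) = Real.exp (-π) * Real.exp (-M) := by
      rw [← Real.exp_add]; congr 1; rw [hM]; ring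
    rw [this, mul_left_comm]
    refine mul_le_mul_of_nonneg_left ?_ (Real.exp_pos _).le
    calc N * PG.eval N * Real.exp (-M) ≤ 8 * (4 / 3 * M) ^ 4 * Real.exp (-M) := by gcongr
      _ = 8 * (4 / 3) ^ 4 * (M ^ 4 * Real.exp (-M)) := by ring
      _ ≤ 8 * (4 / 3) ^ 4 * (40320 / (3 * π * ((k : ℝ) + 1)) ^ 4) := by
        gcongr; exact h5.trans h6
      _ = (8 * (4 / 3) ^ 4 * 40320 / 81) * (1 / π ^ 4 * (1 / ((k : ℝ) + 1) ^ 4)) := by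
        field_simp; ring
      _ ≤ 12600 * (1 / π ^ 4 * (1 / ((k : ℝ) + 1) ^ 4)) := by
        gcongr; norm_num
      _ = _ := by ring
  have h8 := mul_le_mul_of_nonneg_left h7 (by linarith : 0 ≤ y - 1)
  linarith

lemma head_bound (y : ℝ) (hy : 1 ≤ y) (hneg : PG.eval (π * y) < 0) :
    (y - 1) * (Real.exp (-π) * 150) ≤
    PG.eval (π * y) * Real.exp (-(π * y)) - PG.eval π * Real.exp (-π) := by
  have h1 := Real.pi_gt_d2
  have h2 := Real.pi_lt_d2
  have hX : π ≤ π * y := by nlinarith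
  have he : Real.exp (-(π * y)) ≤ Real.exp (-π) := Real.exp_le_exp.mpr (by linarith)
  have h3 : PG.eval (π * y) * Real.exp (-π) ≤ PG.eval (π * y) * Real.exp (-(π * y)) :=
    mul_le_mul_of_nonpos_left he hneg.le
  have h4 : (y - 1) * 150 ≤ PG.eval (π * y) - PG.eval π := by
    rw [PG_eval, PG_eval]
    have e : π * y * (8 * (π * y) ^ 2 - 30 * (π * y) + 15) - π * (8 * π ^ 2 - 30 * π + 15) =
      (y - 1) * (π * (8 * ((π * y) ^ 2 + π * y * π + π ^ 2) - 30 * (π * y + π) + 15)) := by ring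
    rw [e]
    refine mul_le_mul_of_nonneg_left ?_ (by linarith)
    have : 60 ≤ 8 * ((π * y) ^ 2 + π * y * π + π ^ 2) - 30 * (π * y + π) + 15 := by
      nlinarith
    nlinarith
  have h5 := mul_le_mul_of_nonneg_right h4 (Real.exp_pos (-π)).le
  linarith

lemma TT_nonneg (u : ℝ) (hu : 0 ≤ u) : 0 ≤ TT PG u := by
  have hy : 1 ≤ Real.exp (2 * u) := Real.one_le_exp (by linarith)
  have hpi := Real.pi_gt_three
  set y := Real.exp (2 * u) with hyd
  have hx (n : ℕ) : xx n u = π * ((n : ℝ) + 1) ^ 2 * y := rfl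
  by_cases hneg : PG.eval (π * y) < 0
  · have hz4 := hasSum_zeta_four
    have hb : HasSum (fun n : ℕ => (y - 1) * (Real.exp (-π) * ((if n = 0 then (150:ℝ) else 0) -
        12600 / π ^ 4 * (1 / (n : ℝ) ^ 4))))
        ((y - 1) * (Real.exp (-π) * (150 - 12600 / π ^ 4 * (π ^ 4 / 90)))) :=
      (((hasSum_ite_eq 0 (150:ℝ)).sub (hz4.mul_left _)).mul_left _).mul_left _
    have hg : HasSum (fun n => tm PG n u - tm PG n 0) (TT PG u - TT PG 0) :=
      (tm_summable PG u).hasSum.sub (tm_summable PG 0).hasSum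
    have hle := hasSum_le (fun n => ?_) hb hg
    · rw [TT_zero, sub_zero] at hle
      refine le_trans ?_ hle
      have : (150 - 12600 / π ^ 4 * (π ^ 4 / 90)) = 10 := by
        field_simp; norm_num
      rw [this]
      have : 0 ≤ y - 1 := by linarith
      positivity
    · rcases n with _ | k
      · have := head_bound y hy hneg
        simp [tm, xx, ← hyd] at this ⊢
        linarith
      · have := tail_bound k y hy
        have e : ((k : ℝ) + 1 + 1) = k + 2 := by ring
        simp only [tm, xx, ← hyd]
        push_cast
        rw [e]
        simp only [Nat.add_eq_zero_iff, one_ne_zero, and_false, if_false, mul_zero, Real.exp_zero, mul_one]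
        linarith
  · push Not at hneg
    refine tsum_nonneg (fun n => ?_)
    rw [tm]
    refine mul_nonneg ?_ (Real.exp_pos _).le
    rcases n with _ | k
    · rw [hx]; simpa using hneg
    · rw [PG_eval]
      have hk : (0:ℝ) ≤ k := Nat.cast_nonneg k
      have h12 : 12 ≤ xx (k+1) u := by
        rw [hx]; push_cast
        have : 12 ≤ π * ((k : ℝ) + 1 + 1) ^ 2 := by nlinarith [mul_nonneg hk hk]
        nlinarith
      exact mul_nonneg (by linarith) (by nlinarith)

lemma Omega'_nonpos (u : ℝ) (hu : 0 ≤ u) : Omega' u ≤ 0 := by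
  rw [Omega'_eq]
  have := mul_nonneg (Real.exp_pos (u / 2)).le (TT_nonneg u hu)
  linarith

/-- `Ω` is non-increasing on `[0,∞)`; its derivative is `Ω'` which is `≤ 0` there. -/
theorem Omega_antitone :
    AntitoneOn Omega (Set.Ici 0) ∧
    (∀ u : ℝ, HasDerivAt Omega (Omega' u) u) ∧
    (∀ u : ℝ, 0 ≤ u → Omega' u ≤ 0) := by
  refine ⟨?_, Omega_deriv, Omega'_nonpos⟩
  refine antitoneOn_of_deriv_nonpos (convex_Ici 0)
    (fun u _ => (Omega_deriv u).continuousAt.continuousWithinAt)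
    (fun u _ => (Omega_deriv u).differentiableAt.differentiableWithinAt) (fun u hu => ?_)
  rw [(Omega_deriv u).deriv]
  rw [interior_Ici] at hu
  exact Omega'_nonpos u (le_of_lt hu)
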